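/- For every Borel set A ⊆ (−1,1) and every λ > 0, the Lebesgue measure of the set {x ∈ A : |T(χ_A)(x)| > λ} equals 2·m(A)/(e^{πλ} + 1). -/

import Mathlib

open MeasureTheory Filter Set
open scoped Classical

/-- The finite Hilbert transform of `f ∈ L¹(-1,1)`:
`(T f)(t) = lim_{ε→0⁺} (1/π) (∫_{-1}^{t-ε} + ∫_{t+ε}^{1}) f(x)/(x-t) dx`,
defined to be `0` at points where the limit does not exist. -/
noncomputable def finiteHilbertT (f : ℝ → ℂ) (t : ℝ) : ℂ :=
  if h : ∃ L : ℂ, Tendsto (fun ε : ℝ =>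
      (Real.pi : ℂ)⁻¹ * ((∫ x in (-1:ℝ)..(t - ε), f x / ((x : ℂ) - (t : ℂ))) +
        (∫ x in (t + ε)..(1:ℝ), f x / ((x : ℂ) - (t : ℂ)))))
      (nhdsWithin 0 (Set.Ioi 0)) (nhds L)
  then h.choose else 0

/-- Lebesgue measure on the interval `(-1,1)`. -/
noncomputable def m11 : Measure ℝ := volume.restrict (Set.Ioo (-1 : ℝ) 1)

open scoped Topology

/-- The Poisson kernel of the upper half-plane, without its normalizing factor `1 / π`. -/
noncomputable def poissonKer (ε t : ℝ) : ℝ := ε / (t ^ 2 + ε ^ 2)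

lemma continuous_poissonKer {ε : ℝ} (hε : 0 < ε) : Continuous (poissonKer ε) := by
  unfold poissonKer
  refine continuous_const.div (by fun_prop) fun t => ?_
  positivity

lemma poissonKer_pos {ε : ℝ} (hε : 0 < ε) (t : ℝ) : 0 < poissonKer ε t := by
  unfold poissonKer; positivity

lemma poissonKer_eq {ε : ℝ} (hε : 0 < ε) (t : ℝ) :
    poissonKer ε t = ε⁻¹ * (1 + (t / ε) ^ 2)⁻¹ := by
  unfold poissonKer
  field_simp
  ring

lemma integrable_poissonKer {ε : ℝ} (hε : 0 < ε) (x : ℝ) :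
    Integrable (fun y => poissonKer ε (y - x)) := by
  have h : Integrable (poissonKer ε) := by
    simp_rw [funext (poissonKer_eq hε)]
    exact (integrable_inv_one_add_sq.comp_div hε.ne').const_mul _
  exact h.comp_sub_right x

lemma integral_poissonKer {ε : ℝ} (hε : 0 < ε) (x : ℝ) :
    ∫ y, poissonKer ε (y - x) = Real.pi := by
  rw [integral_sub_right_eq_self (poissonKer ε) x]
  simp_rw [poissonKer_eq hε]
  rw [integral_const_mul, Measure.integral_comp_div (fun t => (1 + t ^ 2)⁻¹) ε,
    integral_univ_inv_one_add_sq, abs_of_pos hε, smul_eq_mul]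
  field_simp

lemma poissonKer_le_inv {ε : ℝ} (hε : 0 < ε) (t : ℝ) : poissonKer ε t ≤ ε⁻¹ := by
  rw [poissonKer_eq hε]
  refine mul_le_of_le_one_right (by positivity) (inv_le_one_of_one_le₀ ?_)
  nlinarith [sq_nonneg (t / ε)]

lemma memLp_poissonKer {ε : ℝ} (hε : 0 < ε) (x : ℝ) :
    MemLp (fun y => poissonKer ε (y - x)) 2 := by
  have hc : Continuous fun y => poissonKer ε (y - x) :=
    (continuous_poissonKer hε).comp (by fun_prop)
  rw [memLp_two_iff_integrable_sq hc.aestronglyMeasurable]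
  refine ((integrable_poissonKer hε x).const_mul ε⁻¹).mono'
    (hc.pow 2).aestronglyMeasurable (ae_of_all _ fun y => ?_)
  have h0 := (poissonKer_pos hε (y - x)).le
  rw [Real.norm_eq_abs, abs_of_nonneg (sq_nonneg _), sq]
  exact mul_le_mul_of_nonneg_right (poissonKer_le_inv hε _) h0

lemma exists_poissonKer_le_dyadic {ε : ℝ} (hε : 0 < ε) (t : ℝ) :
    ∃ k : ℕ, |t| ≤ 2 ^ k * ε ∧ poissonKer ε t ≤ 4 * ((1 / 4) ^ k / ε) := by
  by_cases h : |t| ≤ ε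
  · refine ⟨0, by simpa using h, (poissonKer_le_inv hε t).trans ?_⟩
    have : 0 < ε⁻¹ := by positivity
    simp only [pow_zero, one_div]; linarith
  · push Not at h
    obtain ⟨n, hn1, hn2⟩ := exists_nat_pow_near (x := |t| / ε) (y := 2)
      ((one_le_div hε).2 h.le) (by norm_num)
    refine ⟨n + 1, ((div_lt_iff₀ hε).1 hn2).le, ?_⟩
    rw [le_div_iff₀ hε] at hn1
    unfold poissonKer
    have h3 : (2 ^ n * ε) ^ 2 ≤ t ^ 2 := by
      rw [← sq_abs t]; exact pow_le_pow_left₀ (by positivity) hn1 2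
    calc ε / (t ^ 2 + ε ^ 2) ≤ ε / ((2 ^ n * ε) ^ 2) := by
          gcongr; nlinarith [sq_nonneg ε]
      _ = 4 * ((1 / 4) ^ (n + 1) / ε) := by
          have : (4 : ℝ) ^ n = (2 ^ n) ^ 2 := by rw [← pow_mul, mul_comm, pow_mul]; norm_num
          rw [one_div, inv_pow, pow_succ (4 : ℝ), this]
          field_simp

lemma integrable_poissonKer_mul {u : ℝ → ℝ} (hu : MemLp u 2) {ε : ℝ} (hε : 0 < ε) (x : ℝ) :
    Integrable (fun y => poissonKer ε (y - x) * u y) :=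
  (memLp_poissonKer hε x).integrable_mul hu

lemma integrable_poissonKer_mul_sub {u : ℝ → ℝ} (hu : MemLp u 2) {ε : ℝ} (hε : 0 < ε) (x c : ℝ) :
    Integrable (fun y => poissonKer ε (y - x) * (u y - c)) := by
  simp_rw [mul_sub]
  exact (integrable_poissonKer_mul hu hε x).sub ((integrable_poissonKer hε x).mul_const c)

lemma integrable_poissonKer_mul_abs_sub {u : ℝ → ℝ} (hu : MemLp u 2) {ε : ℝ} (hε : 0 < ε)
    (x c : ℝ) : Integrable (fun y => poissonKer ε (y - x) * |u y - c|) := by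
  refine (integrable_poissonKer_mul_sub hu hε x c).norm.congr (ae_of_all _ fun y => ?_)
  simp [abs_of_pos (poissonKer_pos hε (y - x))]

/-- A Poisson integral is dominated by a geometric sum of averages over dyadic balls. -/
lemma integral_poissonKer_mul_le_tsum {v : ℝ → ℝ} (hv : LocallyIntegrable v) (hv0 : ∀ y, 0 ≤ v y)
    {ε : ℝ} (hε : 0 < ε) (x : ℝ)
    {M : ℝ} (hM : ∀ r > 0, ⨍ y in Metric.closedBall x r, v y ≤ M) :
    ∫ y, poissonKer ε (y - x) * v y ≤
      ∑' k : ℕ, 8 * (1 / 2) ^ k * ⨍ y in Metric.closedBall x (2 ^ k * ε), v y := by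
  have hI : ∀ r, IntegrableOn v (Metric.closedBall x r) := fun r =>
    hv.integrableOn_isCompact (isCompact_closedBall x r)
  have hav : ∀ r, 0 ≤ ⨍ y in Metric.closedBall x r, v y := fun r => by
    rw [setAverage_eq]
    exact smul_nonneg (by positivity) (integral_nonneg hv0)
  have hΦ : ∀ r > 0, ∫ y in Metric.closedBall x r, v y =
      2 * r * ⨍ y in Metric.closedBall x r, v y := fun r hr => by
    rw [setAverage_eq, smul_eq_mul, Measure.real, Real.volume_closedBall,
      ENNReal.toReal_ofReal (by positivity)]
    field_simp
  have hnn : ∀ k : ℕ, 0 ≤ 8 * (1 / 2 : ℝ) ^ k * ⨍ y in Metric.closedBall x (2 ^ k * ε), v y :=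
    fun k => mul_nonneg (by positivity) (hav _)
  have hsum : Summable fun k : ℕ =>
      8 * (1 / 2 : ℝ) ^ k * ⨍ y in Metric.closedBall x (2 ^ k * ε), v y := by
    refine Summable.of_nonneg_of_le hnn (fun k => ?_)
      ((summable_geometric_two.mul_left 8).mul_right M)
    exact mul_le_mul_of_nonneg_left (hM _ (by positivity)) (by positivity)
  have hcont : Continuous fun y => poissonKer ε (y - x) :=
    (continuous_poissonKer hε).comp (by fun_prop)
  rw [integral_eq_lintegral_of_nonneg_ae
    (ae_of_all _ fun y => mul_nonneg (poissonKer_pos hε _).le (hv0 y))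
    (hcont.aestronglyMeasurable.mul hv.aestronglyMeasurable)]
  refine ENNReal.toReal_le_of_le_ofReal (tsum_nonneg hnn) ?_
  rw [ENNReal.ofReal_tsum_of_nonneg hnn hsum]
  calc ∫⁻ y, ENNReal.ofReal (poissonKer ε (y - x) * v y)
      ≤ ∫⁻ y, ∑' k : ℕ, (Metric.closedBall x (2 ^ k * ε)).indicator
          (fun y => ENNReal.ofReal (4 * ((1 / 4) ^ k / ε) * v y)) y := by
        refine lintegral_mono fun y => ?_
        obtain ⟨k, hk1, hk2⟩ := exists_poissonKer_le_dyadic hε (y - x)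
        refine le_trans ?_ (ENNReal.le_tsum k)
        rw [indicator_of_mem (by simpa [Real.dist_eq] using hk1)]
        exact ENNReal.ofReal_le_ofReal (mul_le_mul_of_nonneg_right hk2 (hv0 y))
    _ = ∑' k : ℕ, ∫⁻ y in Metric.closedBall x (2 ^ k * ε),
          ENNReal.ofReal (4 * ((1 / 4) ^ k / ε) * v y) := by
        rw [lintegral_tsum]
        · simp_rw [lintegral_indicator Metric.isClosed_closedBall.measurableSet]
        · intro k
          exact ((hv.aestronglyMeasurable.aemeasurable.const_mul _).ennreal_ofReal).indicator
            Metric.isClosed_closedBall.measurableSet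
    _ = _ := by
        congr 1
        ext1 k
        rw [← ofReal_integral_eq_lintegral_ofReal ((hI _).const_mul _)
          (ae_of_all _ fun y => mul_nonneg (by positivity) (hv0 y)), integral_const_mul,
          hΦ _ (by positivity)]
        congr 1
        have : (4 : ℝ) ^ k = 2 ^ k * 2 ^ k := by rw [← mul_pow]; norm_num
        simp only [one_div, inv_pow, this]
        field_simp
        ring

/-- Lebesgue points: Poisson integrals of the oscillation of a square integrable function vanish
in the limit almost everywhere. -/
lemma ae_tendsto_integral_poissonKer_mul_abs_sub {u : ℝ → ℝ} (hu : MemLp u 2) :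
    ∀ᵐ x, Tendsto (fun ε => ∫ y, poissonKer ε (y - x) * |u y - u x|) (𝓝[>] 0) (𝓝 0) := by
  have hloc : LocallyIntegrable u := hu.locallyIntegrable (by norm_num)
  filter_upwards [IsUnifLocDoublingMeasure.ae_tendsto_average_norm_sub volume hloc 1] with x hx
  have hlim : Tendsto (fun r => ⨍ y in Metric.closedBall x r, |u y - u x|) (𝓝[>] 0) (𝓝 0) := by
    refine hx (fun _ => x) id tendsto_id ?_
    filter_upwards [self_mem_nhdsWithin] with r hr
    simpa using (le_of_lt hr)
  have hvloc : LocallyIntegrable fun y => |u y - u x| :=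
    fun y => ((hloc.sub (locallyIntegrable_const (u x))) y).norm
  obtain ⟨M, hM⟩ : ∃ M, ∀ r > 0, ⨍ y in Metric.closedBall x r, |u y - u x| ≤ M := by
    obtain ⟨r₀, hr₀, h1⟩ : ∃ r₀ > 0, ∀ r ∈ Ioo 0 r₀,
        ⨍ y in Metric.closedBall x r, |u y - u x| < 1 := by
      obtain ⟨r₀, hr₀, h⟩ := mem_nhdsGT_iff_exists_Ioo_subset.1
        (hlim.eventually (gt_mem_nhds zero_lt_one))
      exact ⟨r₀, hr₀, h⟩
    refine ⟨1 + |u x| + (∫ y, u y ^ 2) / (2 * r₀) + 1, fun r hr => ?_⟩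
    have hsq0 : 0 ≤ ∫ y, u y ^ 2 := integral_nonneg fun y => sq_nonneg _
    rcases lt_or_ge r r₀ with h | h
    · have := h1 r ⟨hr, h⟩
      have h2 : 0 ≤ (∫ y, u y ^ 2) / (2 * r₀) := by positivity
      linarith [abs_nonneg (u x)]
    · have hvol : volume.real (Metric.closedBall x r) = 2 * r := by
        rw [Measure.real, Real.volume_closedBall, ENNReal.toReal_ofReal (by positivity)]
      have hb : ∫ y in Metric.closedBall x r, |u y - u x| ≤
          2 * r * (1 + |u x|) + ∫ y, u y ^ 2 := by
        have hci : IntegrableOn (fun _ : ℝ => 1 + |u x|) (Metric.closedBall x r) :=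
          integrableOn_const (by rw [Real.volume_closedBall]; exact ENNReal.ofReal_ne_top)
        calc ∫ y in Metric.closedBall x r, |u y - u x|
            ≤ ∫ y in Metric.closedBall x r, ((1 + |u x|) + u y ^ 2) := by
              refine setIntegral_mono (hvloc.integrableOn_isCompact (isCompact_closedBall x r))
                (hci.add hu.integrable_sq.integrableOn) fun y => ?_
              have := abs_sub (u y) (u x)
              have h3 : |u y| ≤ 1 + u y ^ 2 := by nlinarith [sq_abs (u y), sq_nonneg (|u y| - 1)]
              dsimp only
              linarith
          _ = 2 * r * (1 + |u x|) + ∫ y in Metric.closedBall x r, u y ^ 2 := by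
              rw [integral_add hci hu.integrable_sq.integrableOn, setIntegral_const, hvol,
                smul_eq_mul]
          _ ≤ _ := by
              exact add_le_add_right
                (setIntegral_le_integral hu.integrable_sq (ae_of_all _ fun y => sq_nonneg _)) _
      rw [setAverage_eq, hvol, smul_eq_mul]
      calc (2 * r)⁻¹ * ∫ y in Metric.closedBall x r, |u y - u x|
          ≤ (2 * r)⁻¹ * (2 * r * (1 + |u x|) + ∫ y, u y ^ 2) := by gcongr
        _ = 1 + |u x| + (∫ y, u y ^ 2) / (2 * r) := by field_simp
        _ ≤ 1 + |u x| + (∫ y, u y ^ 2) / (2 * r₀) := by gcongr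
        _ ≤ _ := by linarith
  have hM0 : ∀ r, 0 ≤ ⨍ y in Metric.closedBall x r, |u y - u x| := fun r => by
    rw [setAverage_eq]
    exact smul_nonneg (by positivity) (integral_nonneg fun y => abs_nonneg _)
  have hsum : Tendsto (fun ε : ℝ => ∑' k : ℕ, 8 * (1 / 2 : ℝ) ^ k *
      ⨍ y in Metric.closedBall x (2 ^ k * ε), |u y - u x|) (𝓝[>] 0) (𝓝 0) := by
    have := tendsto_tsum_of_dominated_convergence (𝓕 := 𝓝[>] (0 : ℝ)) (g := fun _ : ℕ => (0 : ℝ))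
      (f := fun ε (k : ℕ) => 8 * (1 / 2 : ℝ) ^ k *
        ⨍ y in Metric.closedBall x (2 ^ k * ε), |u y - u x|)
      ((summable_geometric_two.mul_left 8).mul_right M) (fun k => ?_) ?_
    · simpa using this
    · have hk : Tendsto (fun ε : ℝ => 2 ^ k * ε) (𝓝[>] 0) (𝓝[>] 0) := by
        refine tendsto_nhdsWithin_iff.2 ⟨?_, ?_⟩
        · have : Tendsto (fun ε : ℝ => 2 ^ k * ε) (𝓝 0) (𝓝 (2 ^ k * 0)) :=
            (continuous_const.mul continuous_id).tendsto 0
          rw [mul_zero] at this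
          exact this.mono_left nhdsWithin_le_nhds
        · filter_upwards [self_mem_nhdsWithin] with ε hε
          exact mul_pos (a := (2 : ℝ) ^ k) (by positivity) hε
      simpa using (hlim.comp hk).const_mul (8 * (1 / 2 : ℝ) ^ k)
    · filter_upwards [self_mem_nhdsWithin] with ε hε k
      rw [Real.norm_eq_abs, abs_of_nonneg (mul_nonneg (by positivity) (hM0 _))]
      exact mul_le_mul_of_nonneg_left (hM _ (mul_pos (by positivity) hε)) (by positivity)
  refine squeeze_zero' ?_ ?_ hsum
  · filter_upwards [self_mem_nhdsWithin] with ε hε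
    exact integral_nonneg fun y => mul_nonneg (poissonKer_pos hε _).le (abs_nonneg _)
  · filter_upwards [self_mem_nhdsWithin] with ε hε
    exact integral_poissonKer_mul_le_tsum hvloc (fun y => abs_nonneg _) hε x hM

lemma ae_tendsto_integral_poissonKer_mul {u : ℝ → ℝ} (hu : MemLp u 2) :
    ∀ᵐ x, Tendsto (fun ε => ∫ y, poissonKer ε (y - x) * u y) (𝓝[>] 0) (𝓝 (Real.pi * u x)) := by
  filter_upwards [ae_tendsto_integral_poissonKer_mul_abs_sub hu] with x hx
  rw [tendsto_iff_norm_sub_tendsto_zero]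
  refine squeeze_zero' (Eventually.of_forall fun _ => norm_nonneg _) ?_ hx
  filter_upwards [self_mem_nhdsWithin] with ε hε
  have : (∫ y, poissonKer ε (y - x) * u y) - Real.pi * u x =
      ∫ y, poissonKer ε (y - x) * (u y - u x) := by
    simp_rw [mul_sub]
    rw [integral_sub (integrable_poissonKer_mul hu hε x) ((integrable_poissonKer hε x).mul_const _),
      integral_mul_const, integral_poissonKer hε]
  rw [this]
  refine (norm_integral_le_integral_norm _).trans (integral_mono_of_nonneg
    (ae_of_all _ fun y => norm_nonneg _) (integrable_poissonKer_mul_abs_sub hu hε x _)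
    (ae_of_all _ fun y => ?_))
  simp [abs_of_pos (poissonKer_pos hε (y - x))]

/-- The filter of points tending to infinity inside the half-plane `h ≤ Im z`. -/
noncomputable def halfPlaneInfty (h : ℝ) : Filter ℂ := Bornology.cobounded ℂ ⊓ 𝓟 {z | h ≤ z.im}

lemma exists_bound_of_isBigO_inv_sq {F : ℂ → ℂ} {h : ℝ}
    (hO : F =O[halfPlaneInfty h] fun z => z⁻¹ ^ 2) :
    ∃ K ≥ 0, ∃ R ≥ 1, ∀ z : ℂ, h ≤ z.im → R ≤ ‖z‖ → ‖F z‖ ≤ K * (‖z‖ ^ 2)⁻¹ := by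
  obtain ⟨K, hK, hb⟩ := hO.exists_nonneg
  rw [Asymptotics.isBigOWith_iff, halfPlaneInfty, eventually_inf_principal,
    ← comap_norm_atTop, eventually_comap] at hb
  obtain ⟨R, hR⟩ := eventually_atTop.1 hb
  refine ⟨K, hK, max R 1, le_max_right _ _, fun z hz hn => ?_⟩
  simpa using hR ‖z‖ ((le_max_left _ _).trans hn) z rfl hz

/-- Cauchy's theorem on a horizontal line, for functions that are holomorphic above the line and
decay quadratically. -/
lemma integral_line_eq_zero {F : ℂ → ℂ} {h : ℝ} (hh : 0 < h)
    (hF : DifferentiableOn ℂ F {z | h ≤ z.im})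
    (hO : F =O[halfPlaneInfty h] fun z => z⁻¹ ^ 2) :
    Integrable (fun x : ℝ => F (x + h * Complex.I)) ∧ ∫ x : ℝ, F (x + h * Complex.I) = 0 := by
  obtain ⟨K, hK, R, hR, hb⟩ := exists_bound_of_isBigO_inv_sq hO
  have hre : ∀ x y : ℝ, |x| ≤ ‖(x + y * Complex.I : ℂ)‖ := fun x y => by
    simpa using Complex.abs_re_le_norm (x + y * Complex.I : ℂ)
  have him : ∀ x y : ℝ, |y| ≤ ‖(x + y * Complex.I : ℂ)‖ := fun x y => by
    simpa using Complex.abs_im_le_norm (x + y * Complex.I : ℂ)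
  have hcont : Continuous fun x : ℝ => F (x + h * Complex.I) :=
    hF.continuousOn.comp_continuous (by fun_prop) fun x => by simp
  have hF_int : Integrable (fun x : ℝ => F (x + h * Complex.I)) := by
    refine hcont.locallyIntegrable.integrable_of_isBigO_cocompact
      (g := fun x : ℝ => (1 + x ^ 2)⁻¹) ?_ (integrable_inv_one_add_sq.integrableAtFilter _)
    refine Asymptotics.IsBigO.of_bound (K * 2) ?_
    rw [← Metric.cobounded_eq_cocompact, ← comap_norm_atTop, eventually_comap]
    filter_upwards [eventually_ge_atTop R] with a ha x hx
    rw [Real.norm_eq_abs] at hx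
    have hx1 : R ≤ |x| := hx ▸ ha
    refine (hb _ (by simp) (hx1.trans (hre x h))).trans ?_
    have h1 : x ^ 2 ≤ ‖(x + h * Complex.I : ℂ)‖ ^ 2 := by
      rw [← sq_abs]; exact pow_le_pow_left₀ (abs_nonneg _) (hre x h) 2
    have h2 : 1 ≤ x ^ 2 := by rw [← sq_abs]; exact one_le_pow₀ (hR.trans hx1)
    rw [Real.norm_of_nonneg (by positivity), mul_assoc]
    refine mul_le_mul_of_nonneg_left ?_ hK
    rw [← div_eq_mul_inv, inv_eq_one_div, div_le_div_iff₀ (by linarith) (by positivity)]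
    linarith
  refine ⟨hF_int, ?_⟩
  have hlim := intervalIntegral_tendsto_integral hF_int tendsto_neg_atTop_atBot tendsto_id
  refine tendsto_nhds_unique hlim (squeeze_zero_norm' (a := fun T : ℝ => 4 * K * T⁻¹) ?_ ?_)
  · filter_upwards [eventually_ge_atTop R] with T hT
    have hT0 : 0 < T := by linarith
    have hrect := Complex.integral_boundary_rect_eq_zero_of_differentiableOn F
      (⟨-T, h⟩ : ℂ) (⟨T, h + T⟩ : ℂ) (hF.mono ?_)
    · simp only at hrect
      have hbT : ∀ z : ℂ, h ≤ z.im → T ≤ ‖z‖ → ‖F z‖ ≤ K * (T ^ 2)⁻¹ := fun z hz hn =>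
        (hb z hz (hT.trans hn)).trans (by gcongr)
      have htop : ‖∫ x : ℝ in -T..T, F (x + ((h + T : ℝ) : ℂ) * Complex.I)‖ ≤
          K * (T ^ 2)⁻¹ * |T - -T| := by
        refine intervalIntegral.norm_integral_le_of_norm_le_const fun x _ => hbT _ ?_ ?_
        · simpa using hT0.le
        · refine le_trans ?_ (him x (h + T))
          rw [abs_of_pos (by positivity)]; linarith
      have hside : ∀ a : ℝ, |a| = T → ‖∫ y : ℝ in h..(h + T), F (a + y * Complex.I)‖ ≤
          K * (T ^ 2)⁻¹ * |h + T - h| := fun a ha => by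
        refine intervalIntegral.norm_integral_le_of_norm_le_const fun y hy => hbT _ ?_ ?_
        · rw [uIoc_of_le (by linarith)] at hy
          simpa using hy.1.le
        · exact ha ▸ hre a y
      have hr := hside T (abs_of_pos hT0)
      have hl := hside (-T) (by rw [abs_neg, abs_of_pos hT0])
      have heq : (∫ x : ℝ in -T..T, F (x + h * Complex.I)) =
          (∫ x : ℝ in -T..T, F (x + ((h + T : ℝ) : ℂ) * Complex.I)) -
          Complex.I • (∫ y : ℝ in h..(h + T), F ((T : ℝ) + y * Complex.I)) +
          Complex.I • (∫ y : ℝ in h..(h + T), F (((-T : ℝ) : ℂ) + y * Complex.I)) := by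
        linear_combination hrect
      simp only [id]
      rw [heq]
      refine (norm_add_le _ _).trans ((add_le_add_left (norm_sub_le _ _) _).trans ?_)
      rw [norm_smul, norm_smul, Complex.norm_I, one_mul, one_mul]
      refine (add_le_add (add_le_add htop hr) hl).trans (le_of_eq ?_)
      rw [abs_of_pos (by linarith : 0 < T - -T), abs_of_pos (by linarith : 0 < h + T - h)]
      field_simp
      ring
    · intro z hz
      rw [Complex.mem_reProdIm] at hz
      have := hz.2
      simp only at this
      rw [uIcc_of_le (by linarith)] at this
      exact this.1
  · simpa using tendsto_inv_atTop_zero.const_mul (4 * K)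

/-- The Cauchy transform of a subset of the real line. -/
noncomputable def cauchyT (A : Set ℝ) (z : ℂ) : ℂ := ∫ x in A, ((x : ℂ) - z)⁻¹

lemma im_le_norm_sub (x : ℝ) (z : ℂ) : z.im ≤ ‖(x : ℂ) - z‖ := by
  refine (le_abs_self _).trans ?_
  simpa using Complex.abs_im_le_norm ((x : ℂ) - z)

lemma ofReal_sub_ne_zero (x : ℝ) {z : ℂ} (hz : 0 < z.im) : (x : ℂ) - z ≠ 0 :=
  norm_pos_iff.1 (hz.trans_le (im_le_norm_sub x z))

lemma integrableOn_cauchyKer {A : Set ℝ} (hA' : volume A ≠ ⊤) {z : ℂ} (hz : 0 < z.im) :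
    IntegrableOn (fun x : ℝ => ((x : ℂ) - z)⁻¹) A := by
  have hc : Continuous fun x : ℝ => ((x : ℂ) - z)⁻¹ :=
    (by fun_prop : Continuous fun x : ℝ => (x : ℂ) - z).inv₀ fun x => ofReal_sub_ne_zero x hz
  refine Measure.integrableOn_of_bounded (M := z.im⁻¹) hA' hc.aestronglyMeasurable
    (ae_of_all _ fun x => ?_)
  rw [norm_inv]
  exact inv_anti₀ hz (im_le_norm_sub x z)

lemma differentiableAt_cauchyT {A : Set ℝ} (hA' : volume A ≠ ⊤) {z : ℂ} (hz : 0 < z.im) :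
    DifferentiableAt ℂ (cauchyT A) z := by
  have hs : {w : ℂ | z.im / 2 < w.im} ∈ 𝓝 z :=
    (isOpen_lt continuous_const Complex.continuous_im).mem_nhds (by simpa using hz)
  have hpos : ∀ w : ℂ, z.im / 2 < w.im → 0 < w.im := fun w hw => by linarith
  have hc : ∀ w : ℂ, 0 < w.im → Continuous fun x : ℝ => ((x : ℂ) - w)⁻¹ := fun w hw =>
    (by fun_prop : Continuous fun x : ℝ => (x : ℂ) - w).inv₀ fun x => ofReal_sub_ne_zero x hw
  refine (hasDerivAt_integral_of_dominated_loc_of_deriv_le (μ := volume.restrict A)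
    (F := fun w (x : ℝ) => ((x : ℂ) - w)⁻¹) (F' := fun w (x : ℝ) => (((x : ℂ) - w)⁻¹) ^ 2)
    (bound := fun _ => ((z.im / 2)⁻¹) ^ 2) hs ?_ (integrableOn_cauchyKer hA' hz)
    ((hc z hz).pow 2).aestronglyMeasurable ?_ ?_ ?_).2.differentiableAt
  · filter_upwards [hs] with w hw
    exact (hc w (hpos w hw)).aestronglyMeasurable
  · refine ae_of_all _ fun x w hw => ?_
    rw [norm_pow, norm_inv]
    have : z.im / 2 ≤ ‖(x : ℂ) - w‖ := (le_of_lt hw).trans (im_le_norm_sub x w)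
    gcongr
  · exact integrableOn_const hA'
  · refine ae_of_all _ fun x w hw => ?_
    have h := ((hasDerivAt_id w).const_sub (x : ℂ)).inv (ofReal_sub_ne_zero x (hpos w hw))
    simp only [id, neg_neg, one_div, ← inv_pow] at h
    exact h

section Bounded

variable {A : Set ℝ}

lemma volume_ne_top_of_subset_Ioo (hsub : A ⊆ Ioo (-1 : ℝ) 1) : volume A ≠ ⊤ :=
  ((measure_mono hsub).trans_lt (by simp)).ne

lemma norm_cauchyT_le (hsub : A ⊆ Ioo (-1 : ℝ) 1) {h : ℝ} (hh : 0 < h)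
    {z : ℂ} (hz : h ≤ z.im) : ‖cauchyT A z‖ ≤ (1 + 2 / h) / (1 + ‖z‖) * volume.real A := by
  refine norm_setIntegral_le_of_norm_le_const (volume_ne_top_of_subset_Ioo hsub).lt_top
    fun x hx => ?_
  have hx' := hsub hx
  have h1 : ‖(x : ℂ)‖ ≤ 1 := by
    rw [Complex.norm_real, Real.norm_eq_abs, abs_le]; exact ⟨hx'.1.le, hx'.2.le⟩
  have h2 : h ≤ ‖(x : ℂ) - z‖ := hz.trans (im_le_norm_sub x z)
  have h3 : ‖z‖ ≤ ‖(x : ℂ)‖ + ‖(x : ℂ) - z‖ := by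
    have := norm_sub_le (x : ℂ) ((x : ℂ) - z)
    simpa using this
  have h4 : 2 ≤ 2 / h * ‖(x : ℂ) - z‖ := by
    rw [div_mul_eq_mul_div, le_div_iff₀ hh]; linarith
  rw [norm_inv, inv_eq_one_div, div_le_div_iff₀ (by linarith) (by positivity)]
  linarith

lemma cauchyT_isBigO (hsub : A ⊆ Ioo (-1 : ℝ) 1) {h : ℝ} (hh : 0 < h) :
    cauchyT A =O[halfPlaneInfty h] fun z => z⁻¹ := by
  refine Asymptotics.IsBigO.of_bound ((1 + 2 / h) * volume.real A) ?_
  rw [halfPlaneInfty, eventually_inf_principal]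
  filter_upwards [Bornology.eventually_ne_cobounded (0 : ℂ)] with z hz0 hz
  refine (norm_cauchyT_le hsub hh hz).trans ?_
  have : 0 < ‖z‖ := norm_pos_iff.2 hz0
  rw [norm_inv, mul_right_comm, div_eq_mul_inv]
  gcongr
  linarith

lemma tendsto_inv_halfPlaneInfty (h : ℝ) : Tendsto (fun z : ℂ => z⁻¹) (halfPlaneInfty h) (𝓝 0) :=
  tendsto_inv₀_cobounded.mono_left inf_le_left

lemma inv_sub_isBigO (h : ℝ) (w : ℂ) :
    (fun z : ℂ => (z - w)⁻¹) =O[halfPlaneInfty h] fun z => z⁻¹ := by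
  refine Asymptotics.IsBigO.mono ?_ inf_le_left
  refine Asymptotics.IsBigO.inv_rev ?_ ?_
  · refine Asymptotics.IsBigO.of_bound 2 ?_
    filter_upwards [eventually_cobounded_le_norm (2 * ‖w‖)] with z hz
    have := norm_sub_norm_le z w
    linarith
  · filter_upwards [Bornology.eventually_ne_cobounded (0 : ℂ)] with z hz h0
    exact absurd h0 hz

lemma tendsto_cauchyT_halfPlaneInfty (hsub : A ⊆ Ioo (-1 : ℝ) 1) {h : ℝ}
    (hh : 0 < h) : Tendsto (cauchyT A) (halfPlaneInfty h) (𝓝 0) :=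
  (cauchyT_isBigO hsub hh).trans_tendsto (tendsto_inv_halfPlaneInfty h)

lemma differentiableOn_cauchyT (hsub : A ⊆ Ioo (-1 : ℝ) 1) {h : ℝ} (hh : 0 < h) :
    DifferentiableOn ℂ (cauchyT A) {z | h ≤ z.im} := fun _ hz =>
  (differentiableAt_cauchyT (volume_ne_top_of_subset_Ioo hsub)
    (hh.trans_le hz)).differentiableWithinAt

/-- Poisson representation of the Cauchy transform above the line of height `δ`. -/
lemma integral_poissonKer_mul_cauchyT (hsub : A ⊆ Ioo (-1 : ℝ) 1)
    {ε δ : ℝ} (hε : 0 < ε) (hδ : 0 < δ) (x : ℝ) :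
    Integrable (fun y : ℝ => (poissonKer ε (y - x) : ℂ) * cauchyT A (y + δ * Complex.I)) ∧
    ∫ y : ℝ, (poissonKer ε (y - x) : ℂ) * cauchyT A (y + δ * Complex.I) =
      Real.pi * cauchyT A (x + (ε + δ : ℝ) * Complex.I) := by
  set c : ℂ := x + (ε + δ : ℝ) * Complex.I with hc
  set d : ℂ := x + (δ - ε : ℝ) * Complex.I with hd
  have hcim : c.im = ε + δ := by simp [hc]
  have hdim : d.im = δ - ε := by simp [hd]
  set H : ℂ → ℂ := fun z => dslope (cauchyT A) c z * (ε * (z - d)⁻¹) with hH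
  have hdiff : DifferentiableOn ℂ H {z | δ ≤ z.im} := by
    refine DifferentiableOn.mul ?_ ?_
    · refine (Complex.differentiableOn_dslope ?_).2 (differentiableOn_cauchyT hsub hδ)
      have hopen : IsOpen {z : ℂ | δ < z.im} := isOpen_lt continuous_const Complex.continuous_im
      refine mem_of_superset (hopen.mem_nhds (x := c) ?_) fun z (hz : δ < z.im) => hz.le
      simp only [mem_ofPred_eq, hcim]; linarith
    · refine (DifferentiableOn.inv (by fun_prop) fun z hz => ?_).const_mul _
      intro h0
      have : z.im = δ - ε := by rw [sub_eq_zero.1 h0, hdim]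
      have hz' : δ ≤ z.im := hz
      linarith
  have hO : H =O[halfPlaneInfty δ] fun z => z⁻¹ ^ 2 := by
    simp_rw [sq]
    refine Asymptotics.IsBigO.mul ?_ ((inv_sub_isBigO δ d).const_mul_left _)
    have h1 : (fun z => (z - c)⁻¹ * (cauchyT A z - cauchyT A c)) =O[halfPlaneInfty δ]
        fun z => z⁻¹ * 1 := by
      refine (inv_sub_isBigO δ c).mul ?_
      exact ((tendsto_cauchyT_halfPlaneInfty hsub hδ).sub_const _).isBigO_one ℂ
    simp_rw [mul_one] at h1
    refine h1.congr' ?_ EventuallyEq.rfl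
    refine EventuallyEq.filter_mono ?_ inf_le_left
    filter_upwards [Bornology.eventually_ne_cobounded c] with z hz
    rw [dslope_of_ne _ hz, slope_def_field, div_eq_inv_mul]
  obtain ⟨hi, h0⟩ := integral_line_eq_zero hδ hdiff hO
  have hpt : ∀ y : ℝ, (poissonKer ε (y - x) : ℂ) * cauchyT A (y + δ * Complex.I) =
      H (y + δ * Complex.I) + (poissonKer ε (y - x) : ℂ) * cauchyT A c := by
    intro y
    have hyc : (y + δ * Complex.I : ℂ) - c = (y - x : ℝ) - ε * Complex.I := by
      rw [hc]; push_cast; ring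
    have hyd : (y + δ * Complex.I : ℂ) - d = (y - x : ℝ) + ε * Complex.I := by
      rw [hd]; push_cast; ring
    have hc0 : ((y - x : ℝ) - ε * Complex.I : ℂ) ≠ 0 := fun h => by
      have := congrArg Complex.im h
      simp at this; exact hε.ne' this
    have hd0 : ((y - x : ℝ) + ε * Complex.I : ℂ) ≠ 0 := fun h => by
      have := congrArg Complex.im h
      simp at this; exact hε.ne' this
    have hne : (y + δ * Complex.I : ℂ) ≠ c := fun h => hc0 (by rw [← hyc, h, sub_self])
    have hker : (poissonKer ε (y - x) : ℂ) =
        ((y - x : ℝ) - ε * Complex.I : ℂ)⁻¹ * (ε * ((y - x : ℝ) + ε * Complex.I : ℂ)⁻¹) := by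
      have hp : ((((y - x) ^ 2 + ε ^ 2 : ℝ)) : ℂ) =
          ((y - x : ℝ) - ε * Complex.I : ℂ) * ((y - x : ℝ) + ε * Complex.I : ℂ) := by
        push_cast; linear_combination (ε : ℂ) ^ 2 * Complex.I_sq
      rw [poissonKer, Complex.ofReal_div, hp]
      field_simp
    simp only [hH]
    rw [dslope_of_ne _ hne, slope_def_field, hyc, hyd, hker]
    ring
  have hci : Integrable fun y : ℝ => (poissonKer ε (y - x) : ℂ) * cauchyT A c :=
    (integrable_poissonKer hε x).ofReal.mul_const _
  simp_rw [hpt]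
  refine ⟨hi.add hci, ?_⟩
  rw [integral_add hi hci, h0, zero_add, integral_mul_const, integral_complex_ofReal,
    integral_poissonKer hε]

lemma memLp_indicator_one (hA : MeasurableSet A) (hsub : A ⊆ Ioo (-1 : ℝ) 1) :
    MemLp (A.indicator fun _ => (1 : ℝ)) 2 :=
  memLp_indicator_const 2 hA 1 (Or.inr (volume_ne_top_of_subset_Ioo hsub))

lemma cauchyKer_eq {ε : ℝ} (hε : 0 < ε) (x y : ℝ) :
    ((y : ℂ) - (x + ε * Complex.I))⁻¹ =
      ((y - x) / ((y - x) ^ 2 + ε ^ 2) : ℝ) + (poissonKer ε (y - x) : ℝ) * Complex.I := by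
  have hne : ((y : ℂ) - (x + ε * Complex.I)) ≠ 0 := ofReal_sub_ne_zero y (by simpa using hε)
  have hp : ((((y - x) ^ 2 + ε ^ 2 : ℝ)) : ℂ) ≠ 0 := by
    rw [Complex.ofReal_ne_zero]; positivity
  refine inv_eq_of_mul_eq_one_right ?_
  rw [poissonKer, Complex.ofReal_div, Complex.ofReal_div]
  field_simp
  push_cast
  linear_combination (-(ε : ℂ) ^ 2) * Complex.I_sq

lemma integrableOn_cauchyKer_line (hsub : A ⊆ Ioo (-1 : ℝ) 1) {ε : ℝ} (hε : 0 < ε) (x : ℝ) :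
    IntegrableOn (fun y : ℝ => ((y : ℂ) - (x + ε * Complex.I))⁻¹) A :=
  integrableOn_cauchyKer (volume_ne_top_of_subset_Ioo hsub) (by simpa using hε)

lemma re_cauchyT (hsub : A ⊆ Ioo (-1 : ℝ) 1) {ε : ℝ} (hε : 0 < ε) (x : ℝ) :
    (cauchyT A (x + ε * Complex.I)).re = ∫ y in A, (y - x) / ((y - x) ^ 2 + ε ^ 2) := by
  have := integral_re (integrableOn_cauchyKer_line hsub hε x)
  rw [cauchyT, ← RCLike.re_eq_complex_re, ← this]
  simp_rw [cauchyKer_eq hε, RCLike.re_eq_complex_re, Complex.add_re, Complex.re_ofReal_mul,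
    Complex.ofReal_re, Complex.I_re, mul_zero, add_zero]

lemma im_cauchyT_eq_setIntegral (hsub : A ⊆ Ioo (-1 : ℝ) 1) {ε : ℝ} (hε : 0 < ε) (x : ℝ) :
    (cauchyT A (x + ε * Complex.I)).im = ∫ y in A, poissonKer ε (y - x) := by
  have := integral_im (integrableOn_cauchyKer_line hsub hε x)
  rw [cauchyT, ← RCLike.im_eq_complex_im, ← this]
  simp_rw [cauchyKer_eq hε, RCLike.im_eq_complex_im, Complex.add_im, Complex.im_ofReal_mul,
    Complex.ofReal_im, Complex.I_im, mul_one, zero_add]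

lemma im_cauchyT (hA : MeasurableSet A) (hsub : A ⊆ Ioo (-1 : ℝ) 1) {ε : ℝ} (hε : 0 < ε) (x : ℝ) :
    (cauchyT A (x + ε * Complex.I)).im =
      ∫ y, poissonKer ε (y - x) * A.indicator (fun _ => (1 : ℝ)) y := by
  rw [im_cauchyT_eq_setIntegral hsub hε, ← integral_indicator hA]
  congr 1 with y
  by_cases h : y ∈ A <;> simp [h]

lemma im_cauchyT_pos (hsub : A ⊆ Ioo (-1 : ℝ) 1) (h0 : volume A ≠ 0) {ε : ℝ} (hε : 0 < ε) (x : ℝ) :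
    0 < (cauchyT A (x + ε * Complex.I)).im := by
  rw [im_cauchyT_eq_setIntegral hsub hε, setIntegral_pos_iff_support_of_nonneg_ae
    (ae_of_all _ fun y => (poissonKer_pos hε _).le) (integrable_poissonKer hε x).integrableOn]
  have : Function.support (fun y => poissonKer ε (y - x)) = univ :=
    eq_univ_of_forall fun y => (poissonKer_pos hε _).ne'
  rw [this, univ_inter]
  exact pos_iff_ne_zero.2 h0

lemma im_cauchyT_nonneg (hsub : A ⊆ Ioo (-1 : ℝ) 1) {ε : ℝ} (hε : 0 < ε) (x : ℝ) :
    0 ≤ (cauchyT A (x + ε * Complex.I)).im := by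
  rw [im_cauchyT_eq_setIntegral hsub hε]
  exact integral_nonneg fun y => (poissonKer_pos hε _).le

lemma im_cauchyT_lt_pi (hA : MeasurableSet A) (hsub : A ⊆ Ioo (-1 : ℝ) 1) {ε : ℝ} (hε : 0 < ε)
    (x : ℝ) : (cauchyT A (x + ε * Complex.I)).im < Real.pi := by
  rw [im_cauchyT_eq_setIntegral hsub hε, ← integral_poissonKer hε x,
    ← integral_add_compl hA (integrable_poissonKer hε x), lt_add_iff_pos_right,
    setIntegral_pos_iff_support_of_nonneg_ae
    (ae_of_all _ fun y => (poissonKer_pos hε _).le) (integrable_poissonKer hε x).integrableOn]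
  have : Function.support (fun y => poissonKer ε (y - x)) = univ :=
    eq_univ_of_forall fun y => (poissonKer_pos hε _).ne'
  rw [this, univ_inter]
  have hs : Ioo (1 : ℝ) 2 ⊆ Aᶜ := fun y hy hyA => by
    have := (hsub hyA).2; have := hy.1; linarith
  refine lt_of_lt_of_le ?_ (measure_mono hs)
  rw [Real.volume_Ioo]; norm_num

lemma im_cauchyT_le (hA : MeasurableSet A) (hsub : A ⊆ Ioo (-1 : ℝ) 1) {ε : ℝ} (hε : 0 < ε)
    (hε1 : ε ≤ 1) (x : ℝ) : (cauchyT A (x + ε * Complex.I)).im ≤ 16 * (1 + x ^ 2)⁻¹ := by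
  rw [← div_eq_mul_inv, le_div_iff₀ (by positivity)]
  rcases le_or_gt |x| 2 with h | h
  · have h1 := (im_cauchyT_lt_pi hA hsub hε x).le
    have h2 : x ^ 2 ≤ 4 := by rw [← sq_abs]; nlinarith [abs_nonneg x]
    have h3 := im_cauchyT_nonneg hsub hε x
    nlinarith [Real.pi_lt_d2]
  · have hb : ‖∫ y in A, poissonKer ε (y - x)‖ ≤ 4 / x ^ 2 * volume.real A := by
      refine norm_setIntegral_le_of_norm_le_const (volume_ne_top_of_subset_Ioo hsub).lt_top
        fun y hy => ?_
      have hy' := abs_lt.2 (hsub hy)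
      have h1 : |x| / 2 ≤ |y - x| := by
        have := abs_sub_abs_le_abs_sub x y
        rw [abs_sub_comm x y] at this
        linarith
      have h2 : (|x| / 2) ^ 2 ≤ (y - x) ^ 2 := by
        rw [← sq_abs (y - x)]; exact pow_le_pow_left₀ (by positivity) h1 2
      rw [div_pow, sq_abs] at h2
      have hx : 0 < x ^ 2 := by rw [← sq_abs]; positivity
      rw [Real.norm_of_nonneg (poissonKer_pos hε _).le, poissonKer,
        div_le_div_iff₀ (by positivity) hx]
      nlinarith [sq_nonneg ε]
    have hm : volume.real A ≤ 2 := by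
      have := measureReal_mono (μ := volume) hsub (by simp)
      rw [Real.volume_real_Ioo_of_le (by norm_num)] at this
      linarith
    rw [im_cauchyT_eq_setIntegral hsub hε]
    have hx : 4 < x ^ 2 := by rw [← sq_abs]; nlinarith
    have h1 := (le_abs_self _).trans hb
    have h2 : 4 / x ^ 2 * volume.real A ≤ 8 / x ^ 2 := by
      rw [div_mul_eq_mul_div]; gcongr; linarith
    calc (∫ y in A, poissonKer ε (y - x)) * (1 + x ^ 2) ≤ 8 / x ^ 2 * (1 + x ^ 2) := by
          gcongr; exact h1.trans h2
      _ ≤ 16 := by rw [div_mul_eq_mul_div, div_le_iff₀ (by linarith)]; linarith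

lemma continuous_cauchyT_line (hsub : A ⊆ Ioo (-1 : ℝ) 1) {δ : ℝ} (hδ : 0 < δ) :
    Continuous fun x : ℝ => cauchyT A (x + δ * Complex.I) :=
  (differentiableOn_cauchyT hsub hδ).continuousOn.comp_continuous (by fun_prop) fun x => by simp

lemma memLp_cauchyT_line (hsub : A ⊆ Ioo (-1 : ℝ) 1) {δ : ℝ} (hδ : 0 < δ) :
    MemLp (fun x : ℝ => cauchyT A (x + δ * Complex.I)) 2 := by
  have hc := continuous_cauchyT_line hsub hδ
  rw [memLp_two_iff_integrable_sq_norm hc.aestronglyMeasurable]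
  refine (integrable_inv_one_add_sq.const_mul (((1 + 2 / δ) * volume.real A) ^ 2)).mono'
    (hc.norm.pow 2).aestronglyMeasurable (ae_of_all _ fun x => ?_)
  have h1 := norm_cauchyT_le hsub hδ (z := x + δ * Complex.I) (by simp)
  have h2 : |x| ≤ ‖(x + δ * Complex.I : ℂ)‖ := by
    simpa using Complex.abs_re_le_norm (x + δ * Complex.I : ℂ)
  rw [Real.norm_of_nonneg (by positivity)]
  calc ‖cauchyT A (x + δ * Complex.I)‖ ^ 2
      ≤ ((1 + 2 / δ) / (1 + ‖(x + δ * Complex.I : ℂ)‖) * volume.real A) ^ 2 := by gcongr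
    _ = ((1 + 2 / δ) * volume.real A) ^ 2 * ((1 + ‖(x + δ * Complex.I : ℂ)‖) ^ 2)⁻¹ := by
      field_simp
    _ ≤ _ := by
      gcongr
      nlinarith [sq_abs x, abs_nonneg x]

/-- The conjugate Poisson integrals have the same `L²` increments as the Poisson integrals. -/
lemma integral_sq_re_sub_eq (hsub : A ⊆ Ioo (-1 : ℝ) 1) {ε k : ℝ} (hε : 0 < ε) (hk : 0 ≤ k) :
    ∫ x : ℝ, ((cauchyT A (x + ε * Complex.I)).re - (cauchyT A (x + (ε + k : ℝ) * Complex.I)).re) ^ 2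
    = ∫ x : ℝ,
      ((cauchyT A (x + ε * Complex.I)).im - (cauchyT A (x + (ε + k : ℝ) * Complex.I)).im) ^ 2 := by
  have hεk : 0 < ε + k := by linarith
  set F : ℂ → ℂ := fun z => (cauchyT A z - cauchyT A (z + k * Complex.I)) ^ 2 with hFdef
  have hdiff : DifferentiableOn ℂ F {z | ε ≤ z.im} := by
    refine ((differentiableOn_cauchyT hsub hε).sub
      ((differentiableOn_cauchyT hsub hε).comp (by fun_prop) fun z hz => ?_)).pow 2
    have hz' : ε ≤ z.im := hz
    simp; linarith
  have hshift : Tendsto (fun z : ℂ => z + k * Complex.I) (halfPlaneInfty ε) (halfPlaneInfty ε) := by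
    refine tendsto_inf.2 ⟨(tendsto_add_const_cobounded _).mono_left inf_le_left, ?_⟩
    refine tendsto_principal.2 ?_
    rw [halfPlaneInfty, eventually_inf_principal]
    refine Eventually.of_forall fun z hz => ?_
    have hz' : ε ≤ z.im := hz
    simp; linarith
  have hO : F =O[halfPlaneInfty ε] fun z => z⁻¹ ^ 2 := by
    refine Asymptotics.IsBigO.pow ((cauchyT_isBigO hsub hε).sub ?_) 2
    refine ((cauchyT_isBigO hsub hε).comp_tendsto hshift).trans ?_
    have h := inv_sub_isBigO ε (-(k * Complex.I))
    simp_rw [sub_neg_eq_add] at h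
    exact h
  obtain ⟨hi, h0⟩ := integral_line_eq_zero hε hdiff hO
  have hre := integral_re hi
  rw [h0] at hre
  have h1 := (memLp_cauchyT_line hsub hε).sub (memLp_cauchyT_line hsub hεk)
  rw [← sub_eq_zero, ← integral_sub (by simpa using h1.re.integrable_sq)
    (by simpa using h1.im.integrable_sq)]
  refine Eq.trans ?_ hre
  congr 1 with x
  have hxk : (x + ε * Complex.I + k * Complex.I : ℂ) = x + (ε + k : ℝ) * Complex.I := by
    push_cast; ring
  simp only [hFdef, hxk, sq, RCLike.re_eq_complex_re, Complex.mul_re,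
    Complex.sub_re, Complex.sub_im]

lemma norm_toLp_sub_sq {f g : ℝ → ℝ} (hf : MemLp f 2 volume) (hg : MemLp g 2 volume) :
    ‖hf.toLp f - hg.toLp g‖ ^ 2 = ∫ x, (f x - g x) ^ 2 := by
  rw [← MemLp.toLp_sub, ← real_inner_self_eq_norm_sq, L2.inner_def]
  refine integral_congr_ae ?_
  filter_upwards [(hf.sub hg).coeFn_toLp] with x hx
  rw [hx]
  simp [sq]

lemma inner_toLp {f : ℝ → ℝ} (hf : MemLp f 2) (U : Lp ℝ 2 (volume : Measure ℝ)) :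
    inner ℝ (hf.toLp f) U = ∫ x, f x * U x := by
  rw [L2.inner_def]
  refine integral_congr_ae ?_
  filter_upwards [hf.coeFn_toLp] with x hx
  rw [hx]
  simp [mul_comm]

lemma ae_tendsto_im_cauchyT (hA : MeasurableSet A) (hsub : A ⊆ Ioo (-1 : ℝ) 1) :
    ∀ᵐ x : ℝ, Tendsto (fun ε : ℝ => (cauchyT A (x + ε * Complex.I)).im) (𝓝[>] 0)
      (𝓝 (Real.pi * A.indicator (fun _ => (1 : ℝ)) x)) := by
  filter_upwards [ae_tendsto_integral_poissonKer_mul (memLp_indicator_one hA hsub)] with x hx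
  refine hx.congr' ?_
  filter_upwards [self_mem_nhdsWithin] with ε hε
  rw [im_cauchyT hA hsub hε]

lemma memLp_re_cauchyT_line (hsub : A ⊆ Ioo (-1 : ℝ) 1) {δ : ℝ} (hδ : 0 < δ) :
    MemLp (fun x : ℝ => (cauchyT A (x + δ * Complex.I)).re) 2 := (memLp_cauchyT_line hsub hδ).re

lemma memLp_im_cauchyT_line (hsub : A ⊆ Ioo (-1 : ℝ) 1) {δ : ℝ} (hδ : 0 < δ) :
    MemLp (fun x : ℝ => (cauchyT A (x + δ * Complex.I)).im) 2 := (memLp_cauchyT_line hsub hδ).im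

lemma dist_toLp_re_eq (hsub : A ⊆ Ioo (-1 : ℝ) 1) {ε δ : ℝ} (hε : 0 < ε) (hδ : 0 < δ) :
    dist ((memLp_re_cauchyT_line hsub hε).toLp _) ((memLp_re_cauchyT_line hsub hδ).toLp _) =
    dist ((memLp_im_cauchyT_line hsub hε).toLp _) ((memLp_im_cauchyT_line hsub hδ).toLp _) := by
  wlog h : ε ≤ δ generalizing ε δ
  · rw [dist_comm, this hδ hε (le_of_not_ge h), dist_comm]
  rw [dist_eq_norm, dist_eq_norm, ← sq_eq_sq₀ (norm_nonneg _) (norm_nonneg _),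
    norm_toLp_sub_sq, norm_toLp_sub_sq]
  simpa using integral_sq_re_sub_eq hsub hε (k := δ - ε) (by linarith)

lemma tendsto_toLp_im (hA : MeasurableSet A) (hsub : A ⊆ Ioo (-1 : ℝ) 1) :
    Tendsto (fun n : ℕ => (memLp_im_cauchyT_line hsub (Nat.one_div_pos_of_nat (n := n))).toLp _)
      atTop (𝓝 (((memLp_indicator_one hA hsub).const_mul Real.pi).toLp _)) := by
  have hd : Tendsto (fun n : ℕ => 1 / ((n : ℝ) + 1)) atTop (𝓝[>] 0) :=
    tendsto_nhdsWithin_iff.2 ⟨tendsto_one_div_add_atTop_nhds_zero_nat,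
      Eventually.of_forall fun n => mem_Ioi.2 Nat.one_div_pos_of_nat⟩
  rw [tendsto_iff_norm_sub_tendsto_zero]
  suffices h : Tendsto (fun n : ℕ =>
      ‖(memLp_im_cauchyT_line hsub (Nat.one_div_pos_of_nat (n := n))).toLp _ -
        ((memLp_indicator_one hA hsub).const_mul Real.pi).toLp _‖ ^ 2) atTop (𝓝 0) by
    simpa [Real.sqrt_sq] using h.sqrt
  simp_rw [norm_toLp_sub_sq]
  have hlim := tendsto_integral_of_dominated_convergence (μ := volume) (f := fun _ : ℝ => (0 : ℝ))
    (F := fun (n : ℕ) (x : ℝ) => ((cauchyT A (x + ((1 / ((n : ℝ) + 1) : ℝ) : ℂ) * Complex.I)).im -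
      Real.pi * A.indicator (fun _ => (1 : ℝ)) x) ^ 2)
    (fun x => 2 * Real.pi * (16 * (1 + x ^ 2)⁻¹) + 2 * Real.pi ^ 2 * A.indicator (fun _ => 1) x)
    ?_ ?_ ?_ ?_
  · simpa using hlim
  · intro n
    exact (((memLp_im_cauchyT_line hsub (Nat.one_div_pos_of_nat (n := n))).sub
      ((memLp_indicator_one hA hsub).const_mul Real.pi)).integrable_sq).aestronglyMeasurable
  · refine ((integrable_inv_one_add_sq.const_mul _).const_mul _).add (Integrable.const_mul ?_ _)
    exact (integrable_indicator_iff hA).2 (integrableOn_const (volume_ne_top_of_subset_Ioo hsub))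
  · intro n
    refine ae_of_all _ fun x => ?_
    have hn : 0 < 1 / ((n : ℝ) + 1) := Nat.one_div_pos_of_nat
    have hn1 : 1 / ((n : ℝ) + 1) ≤ 1 := by
      rw [div_le_one (by positivity)]; linarith [n.cast_nonneg (α := ℝ)]
    have h1 := im_cauchyT_le hA hsub hn hn1 x
    have h2 := im_cauchyT_nonneg hsub hn x
    have h3 := im_cauchyT_lt_pi hA hsub hn x
    rw [Real.norm_of_nonneg (sq_nonneg _)]
    by_cases hx : x ∈ A
    · simp only [indicator_of_mem hx]
      nlinarith [Real.pi_pos]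
    · simp only [indicator_of_notMem hx]
      nlinarith [Real.pi_pos]
  · filter_upwards [ae_tendsto_im_cauchyT hA hsub] with x hx
    simpa using ((hx.comp hd).sub_const (Real.pi * A.indicator (fun _ => (1 : ℝ)) x)).pow 2

/-- The real part of the Cauchy transform is the Poisson integral of a square integrable
function. -/
lemma exists_re_cauchyT_eq_integral (hA : MeasurableSet A) (hsub : A ⊆ Ioo (-1 : ℝ) 1) :
    ∃ u : ℝ → ℝ, MemLp u 2 ∧ Measurable u ∧ ∀ ε : ℝ, 0 < ε → ∀ x : ℝ,
      Real.pi * (cauchyT A (x + ε * Complex.I)).re = ∫ y, poissonKer ε (y - x) * u y := by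
  have hpos : ∀ n : ℕ, 0 < 1 / ((n : ℝ) + 1) := fun n => Nat.one_div_pos_of_nat
  set r : ℕ → Lp ℝ 2 (volume : Measure ℝ) :=
    fun n => (memLp_re_cauchyT_line hsub (hpos n)).toLp _ with hr
  have hcauchy : CauchySeq r := by
    have hi := (tendsto_toLp_im hA hsub).cauchySeq
    rw [Metric.cauchySeq_iff] at hi ⊢
    intro η hη
    obtain ⟨N, hN⟩ := hi η hη
    refine ⟨N, fun m hm n hn => ?_⟩
    exact (dist_toLp_re_eq hsub (hpos m) (hpos n)).trans_lt (hN m hm n hn)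
  obtain ⟨U, hU⟩ := cauchySeq_tendsto_of_complete hcauchy
  refine ⟨U, Lp.memLp U, (Lp.stronglyMeasurable U).measurable, fun ε hε x => ?_⟩
  have h1 : Tendsto (fun n => inner ℝ ((memLp_poissonKer hε x).toLp _) (r n)) atTop
      (𝓝 (∫ y, poissonKer ε (y - x) * U y)) := by
    rw [← inner_toLp (memLp_poissonKer hε x)]
    exact tendsto_const_nhds.inner hU
  have h2 : ∀ n, inner ℝ ((memLp_poissonKer hε x).toLp _) (r n) =
      Real.pi * (cauchyT A (x + (ε + 1 / ((n : ℝ) + 1) : ℝ) * Complex.I)).re := by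
    intro n
    obtain ⟨hi, he⟩ := integral_poissonKer_mul_cauchyT hsub hε (hpos n) x
    have hre := integral_re hi
    rw [he] at hre
    simp only [RCLike.re_eq_complex_re, Complex.re_ofReal_mul] at hre
    rw [← hre, inner_toLp]
    refine integral_congr_ae ?_
    filter_upwards [(memLp_re_cauchyT_line hsub (hpos n)).coeFn_toLp] with y hy
    rw [hr, hy]
  simp_rw [h2] at h1
  refine tendsto_nhds_unique (Tendsto.const_mul _ ?_) h1
  have hcont : ContinuousAt (cauchyT A) (x + ε * Complex.I) :=
    (differentiableAt_cauchyT (volume_ne_top_of_subset_Ioo hsub) (by simpa using hε)).continuousAt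
  refine (Complex.continuous_re.tendsto _).comp (hcont.tendsto.comp ?_)
  have h3 : Tendsto (fun n : ℕ => ε + 1 / ((n : ℝ) + 1)) atTop (𝓝 (ε + 0)) :=
    tendsto_one_div_add_atTop_nhds_zero_nat.const_add ε
  rw [add_zero] at h3
  exact (((Complex.continuous_ofReal.tendsto ε).comp h3).mul_const Complex.I).const_add (x : ℂ)

/-- The truncated kernel of the Hilbert transform. -/
noncomputable def truncKer (ε t : ℝ) : ℝ := if ε ≤ |t| then t⁻¹ else 0

lemma measurable_truncKer (ε : ℝ) : Measurable (truncKer ε) :=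
  Measurable.ite (measurableSet_le measurable_const measurable_id.abs) measurable_inv
    measurable_const

lemma abs_conjKer_sub_truncKer_le {ε : ℝ} (hε : 0 < ε) (t : ℝ) :
    |t / (t ^ 2 + ε ^ 2) - truncKer ε t| ≤ poissonKer ε t := by
  unfold truncKer poissonKer
  split_ifs with h
  · have ht : t ≠ 0 := fun h0 => by simp [h0] at h; linarith
    have : t / (t ^ 2 + ε ^ 2) - t⁻¹ = -(ε ^ 2 / t) / (t ^ 2 + ε ^ 2) := by
      field_simp; ring
    rw [this, abs_div, abs_neg, abs_div, abs_of_pos (by positivity : 0 < t ^ 2 + ε ^ 2),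
      abs_of_pos (by positivity : 0 < ε ^ 2)]
    gcongr
    rw [div_le_iff₀ (abs_pos.2 ht)]
    nlinarith
  · rw [sub_zero, abs_div, abs_of_pos (by positivity : 0 < t ^ 2 + ε ^ 2)]
    gcongr
    exact (not_le.1 h).le

lemma integrable_conjKer_sub_truncKer {ε : ℝ} (hε : 0 < ε) (x : ℝ) :
    Integrable fun y => (y - x) / ((y - x) ^ 2 + ε ^ 2) - truncKer ε (y - x) := by
  refine (integrable_poissonKer hε x).mono' ?_ (ae_of_all _ fun y =>
    abs_conjKer_sub_truncKer_le hε (y - x))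
  refine Measurable.aestronglyMeasurable ?_
  exact (by fun_prop : Measurable fun y : ℝ => (y - x) / ((y - x) ^ 2 + ε ^ 2)).sub
    ((measurable_truncKer ε).comp (by fun_prop))

lemma integral_conjKer_sub_truncKer (ε x : ℝ) :
    ∫ y, ((y - x) / ((y - x) ^ 2 + ε ^ 2) - truncKer ε (y - x)) = 0 := by
  rw [integral_sub_right_eq_self (fun t => t / (t ^ 2 + ε ^ 2) - truncKer ε t) x]
  have h := integral_neg_eq_self (fun t : ℝ => t / (t ^ 2 + ε ^ 2) - truncKer ε t) volume
  have h2 : ∀ t : ℝ, (-t) / ((-t) ^ 2 + ε ^ 2) - truncKer ε (-t) =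
      -(t / (t ^ 2 + ε ^ 2) - truncKer ε t) := fun t => by
    unfold truncKer
    rw [abs_neg, neg_sq]
    split_ifs
    · rw [inv_neg]; ring
    · ring
  simp_rw [h2, integral_neg] at h
  linarith

lemma ae_tendsto_re_cauchyT_sub_truncKer (hA : MeasurableSet A) (hsub : A ⊆ Ioo (-1 : ℝ) 1) :
    ∀ᵐ x : ℝ, Tendsto (fun ε : ℝ => (cauchyT A (x + ε * Complex.I)).re -
      ∫ y in A, truncKer ε (y - x)) (𝓝[>] 0) (𝓝 0) := by
  filter_upwards [ae_tendsto_integral_poissonKer_mul_abs_sub (memLp_indicator_one hA hsub)]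
    with x hx
  refine squeeze_zero_norm' ?_ hx
  filter_upwards [self_mem_nhdsWithin] with ε hε
  have hε' : 0 < ε := hε
  have hq := integrable_conjKer_sub_truncKer hε' x
  have hconj : IntegrableOn (fun y : ℝ => (y - x) / ((y - x) ^ 2 + ε ^ 2)) A := by
    have := (integrableOn_cauchyKer_line hsub hε' x).re
    simp_rw [cauchyKer_eq hε'] at this
    simp only [RCLike.re_eq_complex_re, Complex.add_re, Complex.re_ofReal_mul,
      Complex.ofReal_re, Complex.I_re, mul_zero, add_zero] at this
    exact this
  have htr : IntegrableOn (fun y : ℝ => truncKer ε (y - x)) A := by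
    refine (hconj.sub hq.integrableOn).congr (ae_of_all _ fun y => ?_)
    simp
  have heq : (cauchyT A (x + ε * Complex.I)).re - ∫ y in A, truncKer ε (y - x) =
      ∫ y, ((y - x) / ((y - x) ^ 2 + ε ^ 2) - truncKer ε (y - x)) *
        (A.indicator (fun _ => (1 : ℝ)) y - A.indicator (fun _ => (1 : ℝ)) x) := by
    rw [re_cauchyT hsub hε', ← integral_sub hconj htr, ← integral_indicator hA]
    simp_rw [mul_sub]
    rw [integral_sub, integral_mul_const, integral_conjKer_sub_truncKer, zero_mul, sub_zero]
    · congr 1 with y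
      by_cases h : y ∈ A <;> simp [h]
    · refine (hq.indicator hA).congr (ae_of_all _ fun y => ?_)
      by_cases h : y ∈ A <;> simp [h]
    · exact hq.mul_const _
  rw [heq]
  refine (norm_integral_le_integral_norm _).trans (integral_mono_of_nonneg
    (ae_of_all _ fun y => norm_nonneg _)
    (integrable_poissonKer_mul_abs_sub (memLp_indicator_one hA hsub) hε' x _)
    (ae_of_all _ fun y => ?_))
  simp only [norm_mul, Real.norm_eq_abs]
  exact mul_le_mul_of_nonneg_right (abs_conjKer_sub_truncKer_le hε' _) (abs_nonneg _)

lemma integral_truncated_eq (hA : MeasurableSet A) (hsub : A ⊆ Ioo (-1 : ℝ) 1) {x ε : ℝ}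
    (hε : 0 < ε) (h1 : -1 ≤ x - ε) (h2 : x + ε ≤ 1) :
    (∫ y in (-1 : ℝ)..(x - ε), A.indicator (fun _ => (1 : ℂ)) y / ((y : ℂ) - (x : ℂ))) +
      (∫ y in (x + ε)..(1 : ℝ), A.indicator (fun _ => (1 : ℂ)) y / ((y : ℂ) - (x : ℂ))) =
      ((∫ y in A, truncKer ε (y - x) : ℝ) : ℂ) := by
  set F : ℝ → ℂ := fun y => A.indicator (fun _ => (1 : ℂ)) y / ((y : ℂ) - (x : ℂ)) with hF
  have hmeas : Measurable F := (measurable_const.indicator hA).div (by fun_prop)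
  have hbound : ∀ S : Set ℝ, MeasurableSet S → volume S ≠ ⊤ → (∀ y ∈ S, ε ≤ |y - x|) →
      IntegrableOn F S := by
    intro S hS hfin hy
    refine Measure.integrableOn_of_bounded (M := ε⁻¹) hfin hmeas.aestronglyMeasurable ?_
    filter_upwards [ae_restrict_mem hS] with y hyS
    have hn : ‖(y : ℂ) - x‖ = |y - x| := by
      rw [← Complex.ofReal_sub, Complex.norm_real, Real.norm_eq_abs]
    have h3 : ‖A.indicator (fun _ => (1 : ℂ)) y‖ ≤ 1 := by
      by_cases h : y ∈ A <;> simp [h]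
    rw [hF, norm_div, hn, inv_eq_one_div]
    exact div_le_div₀ zero_le_one h3 hε (hy y hyS)
  rw [intervalIntegral.integral_of_le h1, intervalIntegral.integral_of_le h2,
    ← integral_Icc_eq_integral_Ioc, ← integral_Icc_eq_integral_Ioc, ← setIntegral_union,
    ← integral_indicator (measurableSet_Icc.union measurableSet_Icc), ← integral_indicator hA,
    ← integral_complex_ofReal]
  · congr 1 with y
    by_cases hy : y ∈ A
    · obtain ⟨ha, hb⟩ := hsub hy
      rw [indicator_of_mem hy]
      by_cases h : ε ≤ |y - x|
      · have hm : y ∈ Icc (-1) (x - ε) ∪ Icc (x + ε) 1 := by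
          rcases le_abs.1 h with h' | h'
          · exact Or.inr ⟨by linarith, hb.le⟩
          · exact Or.inl ⟨ha.le, by linarith⟩
        rw [indicator_of_mem hm, truncKer, if_pos h]
        simp [hy]
      · have hm : y ∉ Icc (-1) (x - ε) ∪ Icc (x + ε) 1 := by
          rintro (⟨_, h'⟩ | ⟨h', _⟩)
          · exact h (le_abs.2 (Or.inr (by linarith)))
          · exact h (le_abs.2 (Or.inl (by linarith)))
        rw [indicator_of_notMem hm, truncKer, if_neg h, Complex.ofReal_zero]
    · rw [indicator_of_notMem hy, Complex.ofReal_zero]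
      refine indicator_apply_eq_zero.2 fun _ => ?_
      simp [hy]
  · rw [Set.disjoint_left]
    rintro y ⟨_, ha⟩ ⟨hb, _⟩
    linarith
  · exact measurableSet_Icc
  · exact hbound _ measurableSet_Icc (by simp) fun y hy => le_abs.2 (Or.inr (by linarith [hy.2]))
  · exact hbound _ measurableSet_Icc (by simp) fun y hy => le_abs.2 (Or.inl (by linarith [hy.1]))

lemma finiteHilbertT_indicator_eq (hA : MeasurableSet A) (hsub : A ⊆ Ioo (-1 : ℝ) 1) {x a : ℝ}
    (hx : x ∈ Ioo (-1 : ℝ) 1)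
    (ha : Tendsto (fun ε : ℝ => ∫ y in A, truncKer ε (y - x)) (𝓝[>] 0) (𝓝 a)) :
    finiteHilbertT (A.indicator fun _ => (1 : ℂ)) x = (Real.pi : ℂ)⁻¹ * (a : ℂ) := by
  have hlim : Tendsto (fun ε : ℝ => (Real.pi : ℂ)⁻¹ *
      ((∫ y in (-1 : ℝ)..(x - ε), A.indicator (fun _ => (1 : ℂ)) y / ((y : ℂ) - (x : ℂ))) +
      (∫ y in (x + ε)..(1 : ℝ), A.indicator (fun _ => (1 : ℂ)) y / ((y : ℂ) - (x : ℂ)))))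
      (𝓝[>] 0) (𝓝 ((Real.pi : ℂ)⁻¹ * (a : ℂ))) := by
    refine Tendsto.const_mul _ ?_
    refine ((Complex.continuous_ofReal.tendsto a).comp ha).congr' ?_
    have hd : 0 < min (x + 1) (1 - x) := lt_min (by linarith [hx.1]) (by linarith [hx.2])
    filter_upwards [Ioo_mem_nhdsGT hd] with ε hε
    have h3 := lt_min_iff.1 hε.2
    exact (integral_truncated_eq hA hsub hε.1 (by linarith) (by linarith)).symm
  have hex : ∃ L : ℂ, Tendsto (fun ε : ℝ => (Real.pi : ℂ)⁻¹ *
      ((∫ y in (-1 : ℝ)..(x - ε), A.indicator (fun _ => (1 : ℂ)) y / ((y : ℂ) - (x : ℂ))) +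
      (∫ y in (x + ε)..(1 : ℝ), A.indicator (fun _ => (1 : ℂ)) y / ((y : ℂ) - (x : ℂ)))))
      (𝓝[>] 0) (𝓝 L) := ⟨_, hlim⟩
  rw [finiteHilbertT, dif_pos hex]
  exact tendsto_nhds_unique hex.choose_spec hlim

/-- Boundary values of the Cauchy transform of `A`, and the Hilbert transform as their real
part. -/
lemma exists_boundary_values (hA : MeasurableSet A) (hsub : A ⊆ Ioo (-1 : ℝ) 1) :
    ∃ u : ℝ → ℝ, Measurable u ∧
      (∀ᵐ x : ℝ, Tendsto (fun ε : ℝ => cauchyT A (x + ε * Complex.I)) (𝓝[>] 0)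
        (𝓝 (u x + (Real.pi * A.indicator (fun _ => (1 : ℝ)) x : ℝ) * Complex.I))) ∧
      ∀ᵐ x : ℝ, x ∈ Ioo (-1 : ℝ) 1 →
        finiteHilbertT (A.indicator fun _ => (1 : ℂ)) x = (Real.pi : ℂ)⁻¹ * (u x : ℂ) := by
  obtain ⟨u, huL, hum, hu⟩ := exists_re_cauchyT_eq_integral hA hsub
  have hre : ∀ᵐ x : ℝ, Tendsto (fun ε : ℝ => (cauchyT A (x + ε * Complex.I)).re) (𝓝[>] 0)
      (𝓝 (u x)) := by
    filter_upwards [ae_tendsto_integral_poissonKer_mul huL] with x hx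
    have h1 := hx.const_mul Real.pi⁻¹
    rw [inv_mul_cancel_left₀ Real.pi_ne_zero] at h1
    refine h1.congr' ?_
    filter_upwards [self_mem_nhdsWithin] with ε hε
    rw [← hu ε hε x, inv_mul_cancel_left₀ Real.pi_ne_zero]
  refine ⟨u, hum, ?_, ?_⟩
  · filter_upwards [hre, ae_tendsto_im_cauchyT hA hsub] with x h1 h2
    have h3 := ((Complex.continuous_ofReal.tendsto _).comp h1).add
      (((Complex.continuous_ofReal.tendsto _).comp h2).mul_const Complex.I)
    refine h3.congr fun ε => ?_
    exact Complex.re_add_im _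
  · filter_upwards [hre, ae_tendsto_re_cauchyT_sub_truncKer hA hsub] with x h1 h2 hx
    refine finiteHilbertT_indicator_eq hA hsub hx ?_
    simpa using h1.sub h2

lemma exp_add_im_pos {w : ℂ} (h0 : 0 < w.im) (hpi : w.im < Real.pi) (s : ℝ) :
    0 < (Complex.exp w + s).im := by
  rw [Complex.add_im, Complex.ofReal_im, add_zero, Complex.exp_im]
  exact mul_pos (Real.exp_pos _) (Real.sin_pos_of_pos_of_lt_pi h0 hpi)

lemma arg_exp_add_le {w : ℂ} (h0 : 0 < w.im) (hpi : w.im < Real.pi) {s : ℝ} (hs : 0 < s) :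
    (Complex.exp w + s).arg ≤ w.im := by
  have harg : (Complex.exp w).arg = w.im := by
    rw [← Complex.log_im, Complex.log_exp (by linarith [Real.pi_pos]) hpi.le]
  set v : ℂ := 1 + s * Complex.exp (-w) with hv
  have hvim : v.im < 0 := by
    rw [hv, Complex.add_im, Complex.one_im, zero_add, Complex.im_ofReal_mul, Complex.exp_im,
      Complex.neg_im, Real.sin_neg]
    have := Real.sin_pos_of_pos_of_lt_pi h0 hpi
    have h2 := Real.exp_pos (-w).re
    have h3 : 0 < s * (Real.exp (-w).re * Real.sin w.im) := by positivity
    linarith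
  have hvarg : v.arg < 0 := Complex.arg_neg_iff.2 hvim
  have hprod : Complex.exp w + s = Complex.exp w * v := by
    rw [hv, mul_add, mul_one, mul_left_comm, ← Complex.exp_add]; simp
  have hv0 : v ≠ 0 := fun h => by rw [h] at hvim; simp at hvim
  rw [hprod, (Complex.arg_mul_eq_add_arg_iff (Complex.exp_ne_zero w) hv0).2, harg]
  · linarith
  · rw [harg]
    exact ⟨by linarith [Complex.neg_pi_lt_arg v], by linarith⟩

lemma one_add_mem_slitPlane {s : ℝ} (hs : 0 < s) : (1 + s : ℂ) ∈ Complex.slitPlane := by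
  refine Or.inl ?_
  simp only [Complex.add_re, Complex.one_re, Complex.ofReal_re]
  linarith

lemma log_exp_add_isBigO {s : ℝ} (hs : 0 < s) :
    (fun w : ℂ => Complex.log (Complex.exp w + s) - Complex.log (1 + s) - w / (1 + s))
      =O[𝓝 0] fun w => w ^ 2 := by
  have han : AnalyticAt ℂ (fun w : ℂ => Complex.log (Complex.exp w + s)) 0 := by
    refine AnalyticAt.clog (by fun_prop) ?_
    rw [Complex.exp_zero]
    exact one_add_mem_slitPlane hs
  obtain ⟨p, hp⟩ := han
  have hd : HasDerivAt (fun w : ℂ => Complex.log (Complex.exp w + s)) (1 / (1 + s)) 0 := by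
    have := ((Complex.hasDerivAt_exp 0).add_const (s : ℂ)).clog
      (by rw [Complex.exp_zero]; exact one_add_mem_slitPlane hs)
    rwa [Complex.exp_zero] at this
  have h1 : p.coeff 1 = 1 / (1 + s) := hp.hasDerivAt.unique hd
  have h0 : p.coeff 0 = Complex.log (1 + s) := by
    have := hp.coeff_zero 1
    rwa [Complex.exp_zero] at this
  have h := hp.isBigO_sub_partialSum_pow 2
  rw [← Asymptotics.isBigO_norm_right]
  simp_rw [norm_pow]
  refine h.congr (fun w => ?_) fun w => rfl
  rw [FormalMultilinearSeries.partialSum, Finset.sum_range_succ, Finset.sum_range_one,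
    FormalMultilinearSeries.apply_eq_pow_smul_coeff,
    FormalMultilinearSeries.apply_eq_pow_smul_coeff, h0, h1]
  simp
  ring

lemma integral_im_log_exp_cauchyT (hA : MeasurableSet A) (hsub : A ⊆ Ioo (-1 : ℝ) 1)
    (h0 : volume A ≠ 0) {s ε : ℝ} (hs : 0 < s) (hε : 0 < ε) :
    ∫ x : ℝ, ((Complex.exp (cauchyT A (x + ε * Complex.I)) + s).arg -
      (cauchyT A (x + ε * Complex.I)).im / (1 + s)) = 0 := by
  have hdiff : DifferentiableOn ℂ (fun z => Complex.log (Complex.exp (cauchyT A z) + s) -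
      Complex.log (1 + s) - cauchyT A z / (1 + s)) {z | ε ≤ z.im} := by
    have hC := differentiableOn_cauchyT hsub hε
    refine DifferentiableOn.sub (DifferentiableOn.sub_const (DifferentiableOn.clog
      (hC.cexp.add_const _) fun z hz => Or.inr ?_) _) (hC.div_const _)
    have hz' : 0 < z.im := hε.trans_le hz
    have h1 := im_cauchyT_pos hsub h0 hz' z.re
    have h2 := im_cauchyT_lt_pi hA hsub hz' z.re
    rw [Complex.re_add_im] at h1 h2
    exact (exp_add_im_pos h1 h2 s).ne'
  have hO : (fun z => Complex.log (Complex.exp (cauchyT A z) + s) -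
      Complex.log (1 + s) - cauchyT A z / (1 + s)) =O[halfPlaneInfty ε] fun z => z⁻¹ ^ 2 :=
    ((log_exp_add_isBigO hs).comp_tendsto (tendsto_cauchyT_halfPlaneInfty hsub hε)).trans
      ((cauchyT_isBigO hsub hε).pow 2)
  obtain ⟨hF_int, hzero⟩ := integral_line_eq_zero hε hdiff hO
  have him := integral_im hF_int
  simp only [RCLike.im_eq_complex_im] at him
  rw [hzero, Complex.zero_im] at him
  rw [← him]
  congr 1 with x
  have h1 : (1 + s : ℂ) = ((1 + s : ℝ) : ℂ) := by push_cast; rfl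
  rw [Complex.sub_im, Complex.sub_im, Complex.log_im, Complex.log_im, h1, Complex.div_ofReal_im,
    Complex.arg_ofReal_of_nonneg (by linarith), sub_zero]

lemma tendsto_arg_exp_add {ι : Type*} {l : Filter ι} {w : ι → ℂ} {a s : ℝ} {P : Prop}
    (hs : 0 < s) (hne : P → Real.exp a ≠ s)
    (hw : ∀ᶠ i in l, 0 < (w i).im ∧ (w i).im < Real.pi)
    (hlim : Tendsto w l (𝓝 (a + ((if P then Real.pi else 0 : ℝ) : ℂ) * Complex.I))) :
    Tendsto (fun i => (Complex.exp (w i) + s).arg) l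
      (𝓝 (if P ∧ s < Real.exp a then Real.pi else 0)) := by
  have hlim' := ((Complex.continuous_exp.tendsto _).comp hlim).add_const (s : ℂ)
  by_cases hP : P
  · have hval : Complex.exp (a + ((if P then Real.pi else 0 : ℝ) : ℂ) * Complex.I) + s =
        ((s - Real.exp a : ℝ) : ℂ) := by
      rw [if_pos hP, Complex.exp_add, Complex.exp_pi_mul_I]
      push_cast
      ring
    rw [hval] at hlim'
    rcases (hne hP).lt_or_gt with h | h
    · rw [if_neg fun hc => hc.2.not_gt h]
      have hpos : 0 < s - Real.exp a := sub_pos.2 h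
      have := (Complex.continuousAt_arg (Complex.ofReal_mem_slitPlane.2 hpos)).tendsto
      rw [Complex.arg_ofReal_of_nonneg hpos.le] at this
      exact this.comp hlim'
    · rw [if_pos ⟨hP, h⟩]
      refine (Complex.tendsto_arg_nhdsWithin_im_nonneg_of_re_neg_of_im_zero
        (by rw [Complex.ofReal_re]; linarith) (Complex.ofReal_im _)).comp
        (tendsto_nhdsWithin_iff.2 ⟨hlim', ?_⟩)
      filter_upwards [hw] with i hi
      exact (exp_add_im_pos hi.1 hi.2 s).le
  · have hval : Complex.exp (a + ((if P then Real.pi else 0 : ℝ) : ℂ) * Complex.I) + s =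
        ((Real.exp a + s : ℝ) : ℂ) := by
      rw [if_neg hP]
      push_cast
      simp
    rw [hval] at hlim'
    rw [if_neg fun hc => hP hc.1]
    have hpos : 0 < Real.exp a + s := add_pos (Real.exp_pos a) hs
    have := (Complex.continuousAt_arg (Complex.ofReal_mem_slitPlane.2 hpos)).tendsto
    rw [Complex.arg_ofReal_of_nonneg hpos.le] at this
    exact this.comp hlim'

lemma volume_real_superlevel_of_null_level (hA : MeasurableSet A) (hsub : A ⊆ Ioo (-1 : ℝ) 1)
    (h0 : volume A ≠ 0) {u : ℝ → ℝ} (hu : Measurable u)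
    (hlim : ∀ᵐ x : ℝ, Tendsto (fun ε : ℝ => cauchyT A (x + ε * Complex.I)) (𝓝[>] 0)
      (𝓝 (u x + (Real.pi * A.indicator (fun _ => (1 : ℝ)) x : ℝ) * Complex.I)))
    {τ : ℝ} (hτ : volume (A ∩ {x | u x = τ}) = 0) :
    volume.real (A ∩ {x | τ < u x}) = volume.real A / (1 + Real.exp τ) := by
  set s := Real.exp τ
  have hs : 0 < s := Real.exp_pos τ
  set E := A ∩ {x | τ < u x}
  have hE : MeasurableSet E := hA.inter (measurableSet_lt measurable_const hu)
  have hE' : volume E ≠ ⊤ :=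
    measure_ne_top_of_subset inter_subset_left (volume_ne_top_of_subset_Ioo hsub)
  set G : ℝ → ℝ → ℝ := fun ε x => (Complex.exp (cauchyT A (x + ε * Complex.I)) + s).arg -
      (cauchyT A (x + ε * Complex.I)).im / (1 + s) with hG
  set g : ℝ → ℝ := fun x => E.indicator (fun _ => Real.pi) x -
      A.indicator (fun _ => Real.pi) x / (1 + s) with hg
  have hlimG : Tendsto (fun ε => ∫ x, G ε x) (𝓝[>] 0) (𝓝 (∫ x, g x)) := by
    refine tendsto_integral_filter_of_dominated_convergence
      (fun x => 16 * (1 + x ^ 2)⁻¹ + 16 * (1 + x ^ 2)⁻¹) ?_ ?_ ?_ ?_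
    · filter_upwards [self_mem_nhdsWithin] with ε hε
      have hc := (continuous_cauchyT_line hsub hε).measurable
      have h1 : Measurable fun x : ℝ => (Complex.exp (cauchyT A (x + ε * Complex.I)) + s).arg :=
        Complex.measurable_arg.comp ((Complex.measurable_exp.comp hc).add_const _)
      exact (h1.sub ((Complex.measurable_im.comp hc).div_const _)).aestronglyMeasurable
    · filter_upwards [Ioc_mem_nhdsGT zero_lt_one] with ε hε
      refine ae_of_all _ fun x => ?_
      have hpos := im_cauchyT_pos hsub h0 hε.1 x
      have hpi := im_cauchyT_lt_pi hA hsub hε.1 x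
      have hle := im_cauchyT_le hA hsub hε.1 hε.2 x
      have harg := arg_exp_add_le hpos hpi hs
      have harg0 : 0 ≤ (Complex.exp (cauchyT A (x + ε * Complex.I)) + s).arg :=
        Complex.arg_nonneg_iff.2 (exp_add_im_pos hpos hpi s).le
      have hdiv : (cauchyT A (x + ε * Complex.I)).im / (1 + s) ≤
          (cauchyT A (x + ε * Complex.I)).im := div_le_self hpos.le (by linarith)
      have hdiv0 : 0 ≤ (cauchyT A (x + ε * Complex.I)).im / (1 + s) := by positivity
      rw [hG, Real.norm_eq_abs, abs_le]
      constructor <;> linarith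
    · exact (integrable_inv_one_add_sq.const_mul 16).add (integrable_inv_one_add_sq.const_mul 16)
    · have hτ' : ∀ᵐ x : ℝ, ¬ (x ∈ A ∧ u x = τ) := measure_eq_zero_iff_ae_notMem.1 hτ
      filter_upwards [hlim, hτ'] with x hx hxτ
      have hval : Real.pi * A.indicator (fun _ => (1 : ℝ)) x = if x ∈ A then Real.pi else 0 := by
        by_cases h : x ∈ A <;> simp [h]
      rw [hval] at hx
      have h1 := tendsto_arg_exp_add (s := s) hs
        (fun hxA he => hxτ ⟨hxA, Real.exp_injective he⟩) (by
          filter_upwards [self_mem_nhdsWithin] with ε hε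
          exact ⟨im_cauchyT_pos hsub h0 hε x, im_cauchyT_lt_pi hA hsub hε x⟩) hx
      have h2 := ((Complex.continuous_im.tendsto _).comp hx).div_const (1 + s)
      have h3 : (if x ∈ A ∧ s < Real.exp (u x) then Real.pi else 0) =
          E.indicator (fun _ => Real.pi) x := by
        by_cases h : x ∈ E
        · rw [indicator_of_mem h, if_pos ⟨h.1, Real.exp_lt_exp.2 h.2⟩]
        · rw [indicator_of_notMem h, if_neg fun hc => h ⟨hc.1, Real.exp_lt_exp.1 hc.2⟩]
      have h4 : (u x + ((if x ∈ A then Real.pi else 0 : ℝ) : ℂ) * Complex.I).im =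
          A.indicator (fun _ => Real.pi) x := by
        rw [Complex.add_im, Complex.im_ofReal_mul, Complex.ofReal_im, Complex.I_im, zero_add,
          mul_one]
        exact if_congr Iff.rfl rfl rfl
      rw [h3] at h1
      rw [h4] at h2
      exact h1.sub h2
  have hzero : ∫ x, g x = 0 := by
    refine tendsto_nhds_unique (hlimG.congr' ?_) tendsto_const_nhds
    filter_upwards [self_mem_nhdsWithin] with ε hε
    exact integral_im_log_exp_cauchyT hA hsub h0 hs hε
  have hA' := volume_ne_top_of_subset_Ioo hsub
  rw [hg, integral_sub, integral_div, integral_indicator hE, integral_indicator hA,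
    setIntegral_const, setIntegral_const, smul_eq_mul, smul_eq_mul] at hzero
  · have hpi := Real.pi_pos
    have : Real.pi * (volume.real E - volume.real A / (1 + s)) = 0 := by
      rw [← hzero]; ring
    rcases mul_eq_zero.1 this with h | h
    · exact absurd h hpi.ne'
    · linarith
  · exact (integrable_indicator_iff hE).2 (integrableOn_const hE')
  · exact ((integrable_indicator_iff hA).2 (integrableOn_const hA')).div_const _

lemma volume_real_superlevel (hA : MeasurableSet A) (hsub : A ⊆ Ioo (-1 : ℝ) 1)
    (h0 : volume A ≠ 0) {u : ℝ → ℝ} (hu : Measurable u)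
    (hlim : ∀ᵐ x : ℝ, Tendsto (fun ε : ℝ => cauchyT A (x + ε * Complex.I)) (𝓝[>] 0)
      (𝓝 (u x + (Real.pi * A.indicator (fun _ => (1 : ℝ)) x : ℝ) * Complex.I))) (τ : ℝ) :
    volume.real (A ∩ {x | τ < u x}) = volume.real A / (1 + Real.exp τ) ∧
      volume.real (A ∩ {x | τ ≤ u x}) = volume.real A / (1 + Real.exp τ) := by
  have hfin : ∀ S : Set ℝ, volume (A ∩ S) ≠ ⊤ := fun S =>
    measure_ne_top_of_subset inter_subset_left (volume_ne_top_of_subset_Ioo hsub)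
  have hdense : Dense {t : ℝ | volume (A ∩ {x | u x = t}) = 0} := by
    refine (Set.Countable.dense_compl ℝ
      (Measure.countable_meas_level_set_pos (μ := volume.restrict A) hu)).mono fun t ht => ?_
    have ht' : volume.restrict A {x | u x = t} = 0 := by simpa using ht
    rwa [Measure.restrict_apply (measurableSet_eq_fun hu measurable_const), inter_comm] at ht'
  have hcont : Continuous fun t : ℝ => volume.real A / (1 + Real.exp t) :=
    continuous_const.div (by fun_prop) fun t => by positivity
  have hle : volume.real (A ∩ {x | τ < u x}) ≤ volume.real (A ∩ {x | τ ≤ u x}) :=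
    measureReal_mono (inter_subset_inter_right _ fun x (hx : τ < u x) => hx.le) (hfin _)
  have hlower : volume.real A / (1 + Real.exp τ) ≤ volume.real (A ∩ {x | τ < u x}) := by
    by_contra! h
    obtain ⟨r, hr, hr'⟩ := mem_nhdsGE_iff_exists_Ico_subset.1
      (mem_nhdsWithin_of_mem_nhds (hcont.continuousAt.eventually (lt_mem_nhds h)))
    obtain ⟨t, ht, htr⟩ := hdense.exists_between (show τ < r from hr)
    have h1 := volume_real_superlevel_of_null_level hA hsub h0 hu hlim ht
    have h2 : volume.real (A ∩ {x | t < u x}) ≤ volume.real (A ∩ {x | τ < u x}) :=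
      measureReal_mono (inter_subset_inter_right _ fun x (hx : t < u x) => htr.1.trans hx) (hfin _)
    have h3 : _ < volume.real A / (1 + Real.exp t) := hr' ⟨htr.1.le, htr.2⟩
    linarith
  have hupper : volume.real (A ∩ {x | τ ≤ u x}) ≤ volume.real A / (1 + Real.exp τ) := by
    by_contra! h
    obtain ⟨r, hr, hr'⟩ := mem_nhdsLE_iff_exists_Ioc_subset.1
      (mem_nhdsWithin_of_mem_nhds (hcont.continuousAt.eventually (gt_mem_nhds h)))
    obtain ⟨t, ht, htr⟩ := hdense.exists_between (show r < τ from hr)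
    have h1 := volume_real_superlevel_of_null_level hA hsub h0 hu hlim ht
    have h2 : volume.real (A ∩ {x | τ ≤ u x}) ≤ volume.real (A ∩ {x | t < u x}) :=
      measureReal_mono (inter_subset_inter_right _ fun x (hx : τ ≤ u x) => htr.2.trans_le hx)
        (hfin _)
    have h3 : volume.real A / (1 + Real.exp t) < _ := hr' ⟨htr.1, htr.2.le⟩
    linarith
  exact ⟨le_antisymm (hle.trans hupper) hlower, le_antisymm hupper (hlower.trans hle)⟩

end Bounded

/-- For every Borel `A ⊆ (-1,1)` and `λ > 0`,
`m {x ∈ A : |T(χ_A)(x)| > λ} = 2 m(A) / (e^{πλ} + 1)`. -/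
theorem stmt5 (A : Set ℝ) (hA : MeasurableSet A) (hsub : A ⊆ Set.Ioo (-1 : ℝ) 1)
    (lam : ℝ) (hlam : 0 < lam) :
    volume {x ∈ A | lam < ‖finiteHilbertT (A.indicator fun _ => (1 : ℂ)) x‖} =
      ENNReal.ofReal (2 / (Real.exp (Real.pi * lam) + 1)) * volume A := by
  by_cases h0 : volume A = 0
  · rw [h0, mul_zero]
    exact measure_mono_null (sep_subset _ _) h0
  obtain ⟨u, hu, hlim, hT⟩ := exists_boundary_values hA hsub
  have hA' := volume_ne_top_of_subset_Ioo hsub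
  have hfin : ∀ S : Set ℝ, volume (A ∩ S) ≠ ⊤ := fun S =>
    measure_ne_top_of_subset inter_subset_left hA'
  have hset : {x ∈ A | lam < ‖finiteHilbertT (A.indicator fun _ => (1 : ℂ)) x‖} =ᵐ[volume]
      ((A ∩ {x | Real.pi * lam < u x}) ∪ (A \ (A ∩ {x | -(Real.pi * lam) ≤ u x})) : Set ℝ) := by
    filter_upwards [hT] with x hx
    refine propext ?_
    change (x ∈ A ∧ lam < ‖finiteHilbertT (A.indicator fun _ => (1 : ℂ)) x‖) ↔
      ((x ∈ A ∧ Real.pi * lam < u x) ∨ (x ∈ A ∧ ¬ (x ∈ A ∧ -(Real.pi * lam) ≤ u x)))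
    by_cases hxA : x ∈ A
    · rw [hx (hsub hxA), norm_mul, norm_inv, Complex.norm_real, Complex.norm_real,
        Real.norm_of_nonneg Real.pi_pos.le, Real.norm_eq_abs, lt_inv_mul_iff₀ Real.pi_pos,
        lt_abs]
      simp only [hxA, true_and, not_le]
      rw [lt_neg]
    · simp [hxA]
  have hmeas : MeasurableSet (A ∩ {x | -(Real.pi * lam) ≤ u x}) :=
    hA.inter (measurableSet_le measurable_const hu)
  have hpos : 0 < Real.pi * lam := mul_pos Real.pi_pos hlam
  have hdisj : Disjoint (A ∩ {x | Real.pi * lam < u x})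
      (A \ (A ∩ {x | -(Real.pi * lam) ≤ u x})) := by
    rw [Set.disjoint_left]
    rintro x ⟨hxA, hx⟩ ⟨_, hx'⟩
    have h1 : Real.pi * lam < u x := hx
    exact hx' ⟨hxA, by change -(Real.pi * lam) ≤ u x; linarith⟩
  have hreal : volume.real ((A ∩ {x | Real.pi * lam < u x}) ∪
      (A \ (A ∩ {x | -(Real.pi * lam) ≤ u x}))) =
      2 / (Real.exp (Real.pi * lam) + 1) * volume.real A := by
    rw [measureReal_union hdisj (hA.diff hmeas) (hfin _)
        (measure_ne_top_of_subset sdiff_subset hA'),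
      measureReal_sdiff inter_subset_left hmeas hA',
      (volume_real_superlevel hA hsub h0 hu hlim _).1,
      (volume_real_superlevel hA hsub h0 hu hlim _).2, Real.exp_neg]
    have := Real.exp_pos (Real.pi * lam)
    field_simp
    ring
  have hfin' : volume ((A ∩ {x | Real.pi * lam < u x}) ∪
      (A \ (A ∩ {x | -(Real.pi * lam) ≤ u x}))) ≠ ⊤ :=
    measure_ne_top_of_subset (union_subset inter_subset_left sdiff_subset) hA'
  rw [measure_congr hset, ← ofReal_measureReal hfin', hreal, ENNReal.ofReal_mul (by positivity),
    ofReal_measureReal hA']
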